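/- arXiv:2403.09644 — 2 statements merged into one kernel-verified Lean document; each statement's English description precedes it below -/
import Mathlib

section
/- Let p be a prime, c ≥ 0, and n = (c+1)·p. Then e_{n−1−c}(n) ≡ (−1)^{c+1} (mod p). -/
/-- `esymm k n` is the sum of the products of all `k`-element subsets of `{1, …, n-1}`. -/
def esymm (k n : ℕ) : ℤ :=
  ∑ S ∈ (Finset.Icc 1 (n - 1)).powersetCard k, ∏ i ∈ S, (i : ℤ)

open Polynomial

theorem prod_range_X_add_C_natCast_zmod (p : ℕ) [Fact p.Prime] :
    ∏ i ∈ Finset.range p, (X + C (i : ZMod p)) = X ^ p - X := by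
  have hp : 1 < p := (Fact.out : p.Prime).one_lt
  have hmonic : (X ^ p - X : (ZMod p)[X]).Monic := by
    apply monic_X_pow_sub
    simpa using hp
  have hroots := FiniteField.roots_X_pow_card_sub_X (ZMod p)
  rw [ZMod.card] at hroots
  have hprod : ∏ a : ZMod p, (X - C a) = X ^ p - X := by
    have := prod_multiset_X_sub_C_of_monic_of_roots_card_eq hmonic
      (by rw [hroots, FiniteField.X_pow_card_sub_X_natDegree_eq _ hp]; simp)
    rwa [hroots] at this
  rw [← hprod, ← Equiv.prod_comp (Equiv.neg (ZMod p))]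
  refine Finset.prod_bij (fun i _ => (i : ZMod p)) (by simp) ?_ ?_ (by simp)
  · intro a ha b hb hab
    rw [Finset.mem_range] at ha hb
    rwa [ZMod.natCast_eq_natCast_iff', Nat.mod_eq_of_lt ha, Nat.mod_eq_of_lt hb] at hab
  · intro b _
    exact ⟨b.val, by simpa using b.val_lt, by simp⟩

theorem prod_range_mul_X_add_C_natCast_zmod (p m : ℕ) [Fact p.Prime] :
    ∏ i ∈ Finset.range (m * p), (X + C (i : ZMod p)) = (X ^ p - X) ^ m := by
  induction m with
  | zero => simp
  | succ m ih =>
    rw [add_mul, one_mul, Finset.prod_range_add, ih, pow_succ]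
    simp [← prod_range_X_add_C_natCast_zmod p]

theorem esymm_intCast_eq_coeff {R : Type*} [CommRing R] {n k : ℕ} (hk : k ≤ n - 1) :
    (esymm (n - 1 - k) n : R) = (∏ i ∈ Finset.Icc 1 (n - 1), (X + C (i : R))).coeff k := by
  rw [Finset.prod_X_add_C_coeff _ _ (by simpa using hk)]
  simp [esymm]

theorem stmt_10 (p c n : ℕ) (hp : p.Prime) (hn : n = (c + 1) * p) :
    esymm (n - 1 - c) n ≡ (-1) ^ (c + 1) [ZMOD p] := by
  have : Fact p.Prime := ⟨hp⟩
  have hcn : c + 1 ≤ n := hn ▸ Nat.le_mul_of_pos_right _ hp.pos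
  rw [← ZMod.intCast_eq_intCast_iff, esymm_intCast_eq_coeff (by lia)]
  have hX : (∏ i ∈ Finset.Icc 1 (n - 1), (X + C (i : ZMod p))) * X = (X ^ p - X) ^ (c + 1) := by
    rw [← prod_range_mul_X_add_C_natCast_zmod, ← hn]
    obtain ⟨k, rfl⟩ : ∃ k, n = k + 1 := ⟨n - 1, by lia⟩
    rw [Finset.prod_range_succ', Finset.range_eq_Ico,
      Finset.prod_Ico_add' (fun i : ℕ => X + C (i : ZMod p))]
    simp [← Finset.Ico_add_one_right_eq_Icc]
  have hfactor : (X ^ p - X : (ZMod p)[X]) = X * (X ^ (p - 1) - 1) := by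
    rw [mul_sub, mul_one, mul_pow_sub_one hp.ne_zero]
  have hp1 : p - 1 ≠ 0 := by have := hp.two_le; lia
  rw [← coeff_mul_X, hX, hfactor, mul_pow, coeff_X_pow_mul', if_pos le_rfl,
    Nat.sub_self, coeff_zero_eq_eval_zero]
  simp [hp1]
end

section
/- Let c ≥ 0 and let n be an integer with n ≥ (2c+3)². Then ((−1)^c + e_{n−1−c}(n)) · (c+1) ≡ 0 (mod n) if and only if n = (c+1)·p for some prime p. -/
open Polynomial in
theorem FiniteField.prod_X_add_C_eq (K : Type*) [Field K] [Fintype K] :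
    ∏ a : K, (X + C a) = X ^ Fintype.card K - X := by
  have hdeg := FiniteField.X_pow_card_sub_X_natDegree_eq K (Fintype.one_lt_card (α := K))
  have hmonic : (X ^ Fintype.card K - X : K[X]).Monic :=
    monic_X_pow_sub (by rw [degree_X]; exact_mod_cast Fintype.one_lt_card)
  have hprod := prod_multiset_X_sub_C_of_monic_of_roots_card_eq hmonic (by
    rw [FiniteField.roots_X_pow_card_sub_X, hdeg]; rfl)
  rw [FiniteField.roots_X_pow_card_sub_X] at hprod
  rw [← hprod]
  refine Fintype.prod_equiv (Equiv.neg K) _ (fun a => X - C a) fun a => ?_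
  simp

theorem ZMod.prod_range_natCast {M : Type*} [CommMonoid M] (n : ℕ) [NeZero n] (f : ZMod n → M) :
    ∏ i ∈ Finset.range n, f i = ∏ a : ZMod n, f a := by
  refine Finset.prod_bij' (fun i _ => (i : ZMod n)) (fun a _ => a.val) ?_ ?_ ?_ ?_ ?_
  · simp
  · intro a _
    exact Finset.mem_range.mpr a.val_lt
  · intro i hi
    exact ZMod.val_cast_of_lt (Finset.mem_range.mp hi)
  · simp
  · simp

theorem ZMod.prod_range_mul_natCast {M : Type*} [CommMonoid M] (n m : ℕ) [NeZero n]
    (f : ZMod n → M) :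
    ∏ i ∈ Finset.range (n * m), f i = (∏ a : ZMod n, f a) ^ m := by
  induction m with
  | zero => simp
  | succ m ih =>
    rw [Nat.mul_succ, Finset.prod_range_add, ih, pow_succ, ← ZMod.prod_range_natCast n f]
    simp

open Polynomial in
/-- Modulo a prime `p`, the numbers `esymm` for `n = p * m` are coefficients of `(X ^ p - X) ^ m`. -/
theorem esymm_cast_eq_coeff (p m c : ℕ) [Fact p.Prime] (hc : c + 1 ≤ p * m) :
    (esymm (p * m - 1 - c) (p * m) : ZMod p) =
      ((X ^ (p - 1) - 1 : (ZMod p)[X]) ^ m * X ^ m).coeff (c + 1) := by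
  have hp : p - 1 + 1 = p := Nat.sub_add_cancel (Fact.out : p.Prime).one_le
  have hX : (X ^ (p - 1) - 1 : (ZMod p)[X]) ^ m * X ^ m = (X ^ p - X) ^ m := by
    rw [← mul_pow, sub_mul, ← pow_succ, hp, one_mul]
  have hcard := FiniteField.prod_X_add_C_eq (ZMod p)
  rw [ZMod.card] at hcard
  have hIcc : ∏ i ∈ Finset.range (p * m), (X + C ((i : ℕ) : ZMod p)) =
      (∏ i ∈ Finset.Icc 1 (p * m - 1), (X + C ((i : ℕ) : ZMod p))) * X := by
    obtain ⟨k, hk⟩ : ∃ k, p * m = k + 1 := ⟨p * m - 1, by omega⟩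
    rw [hk, Finset.prod_range_eq_mul_Ico _ (Nat.succ_pos k), mul_comm]
    simp [← Finset.Ico_add_one_right_eq_Icc]
  rw [hX, ← hcard, ← ZMod.prod_range_mul_natCast p m (fun a => X + C a), hIcc, coeff_mul_X,
    Finset.prod_X_add_C_coeff _ _ (by simp; omega)]
  simp [esymm]

open Polynomial in
theorem Polynomial.coeff_X_pow_sub_one_pow_of_lt {R : Type*} [CommRing R] {q d : ℕ} (m : ℕ)
    (hd : d < q) : ((X ^ q - 1 : R[X]) ^ m).coeff d = if d = 0 then (-1) ^ m else 0 := by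
  have h : (X ^ q - 1 : R[X]) ^ m = expand R q ((X - 1) ^ m) := by simp
  rw [h, coeff_expand (by omega)]
  rcases Nat.eq_zero_or_pos d with rfl | hd0
  · simp [coeff_zero_eq_eval_zero]
  · rw [if_neg (Nat.not_dvd_of_pos_of_lt hd0 hd), if_neg hd0.ne']

/-- If a prime `p` divides `(-1) ^ c + esymm (n - 1 - c) n`, where `n = p * m > c`, then
`m ≤ c + 1`. -/
theorem le_of_prime_dvd_neg_one_pow_add_esymm {p m c : ℕ} (hp : p.Prime) (hc : c + 1 ≤ p * m)
    (h : (p : ℤ) ∣ (-1) ^ c + esymm (p * m - 1 - c) (p * m)) : m ≤ c + 1 := by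
  have : Fact p.Prime := ⟨hp⟩
  rw [← ZMod.intCast_zmod_eq_zero_iff_dvd] at h
  push_cast at h
  rw [esymm_cast_eq_coeff p m c hc, Polynomial.coeff_mul_X_pow'] at h
  by_contra hmc
  simp [hmc] at h

/-- For a prime `p > c + 1` and `0 < m ≤ c + 1`, the prime `p` divides
`(-1) ^ c + esymm (p * m - 1 - c) (p * m)` exactly when `m = c + 1`. -/
theorem prime_dvd_neg_one_pow_add_esymm_iff {p m c : ℕ} (hp : p.Prime) (hcp : c + 1 < p)
    (hm : 0 < m) (hmc : m ≤ c + 1) :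
    (p : ℤ) ∣ (-1) ^ c + esymm (p * m - 1 - c) (p * m) ↔ m = c + 1 := by
  have : Fact p.Prime := ⟨hp⟩
  have hc : c + 1 ≤ p * m := hcp.le.trans (Nat.le_mul_of_pos_right p hm)
  rw [← ZMod.intCast_zmod_eq_zero_iff_dvd]
  push_cast
  rw [esymm_cast_eq_coeff p m c hc, Polynomial.coeff_mul_X_pow', if_pos hmc,
    Polynomial.coeff_X_pow_sub_one_pow_of_lt m (by omega)]
  by_cases h : m = c + 1
  · subst h
    simp [pow_succ]
  · rw [if_neg (by omega)]
    simp [h]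

theorem stmt_13 (c n : ℕ) (hn : (2 * c + 3) ^ 2 ≤ n) :
    ((-1) ^ c + esymm (n - 1 - c) n) * (c + 1) ≡ 0 [ZMOD n] ↔
      ∃ p : ℕ, p.Prime ∧ n = (c + 1) * p := by
  have hlarge : ∀ p m : ℕ, n = p * m → m ≤ c + 1 → c + 1 < p := by
    intro p m h hm
    by_contra! hp
    have := Nat.mul_le_mul hp hm
    nlinarith
  rw [Int.modEq_zero_iff_dvd]
  constructor
  · intro h
    have hc0 : 0 < c + 1 := c.succ_pos
    have hn0 : c + 1 < n := by nlinarith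
    set g := n.gcd (c + 1) with hg
    have hgpos : 0 < g := Nat.gcd_pos_of_pos_right n hc0
    have hquot : ((n / g : ℕ) : ℤ) ∣ (-1) ^ c + esymm (n - 1 - c) n := by
      rw [Int.natCast_dvd, ← (Nat.coprime_div_gcd_div_gcd hgpos).dvd_mul_right (n := (c + 1) / g),
        ← Nat.mul_dvd_mul_iff_right hgpos, mul_assoc, Nat.div_mul_cancel (n.gcd_dvd_left _),
        Nat.div_mul_cancel (n.gcd_dvd_right _)]
      have := Int.natCast_dvd.mp h
      rwa [Int.natAbs_mul, show ((c : ℤ) + 1).natAbs = c + 1 by omega] at this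
    have hne : n / g ≠ 1 := by
      intro h1
      have hgn : n = g := Nat.eq_of_dvd_of_div_eq_one (n.gcd_dvd_left _) h1 |>.symm
      have := Nat.gcd_le_right n hc0
      omega
    obtain ⟨p, hp, hpn⟩ := Nat.exists_prime_and_dvd hne
    have hdvd := (Int.natCast_dvd_natCast.mpr hpn).trans hquot
    obtain ⟨m, hm⟩ := hpn.trans (Nat.div_dvd_of_dvd (n.gcd_dvd_left _))
    have hm0 : 0 < m := Nat.pos_of_ne_zero (by rintro rfl; omega)
    rw [hm] at hdvd
    have hmc := le_of_prime_dvd_neg_one_pow_add_esymm hp (hm ▸ hn0.le) hdvd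
    have hmeq := (prime_dvd_neg_one_pow_add_esymm_iff hp (hlarge p m hm hmc) hm0 hmc).mp hdvd
    exact ⟨p, hp, by rw [hm, hmeq, mul_comm]⟩
  · rintro ⟨p, hp, rfl⟩
    have := (prime_dvd_neg_one_pow_add_esymm_iff hp
      (hlarge p (c + 1) (mul_comm _ _) le_rfl) c.succ_pos le_rfl).mpr rfl
    rw [mul_comm (c + 1) p]
    push_cast
    exact mul_dvd_mul_right this _
end
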